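/- Let μ be a doubling positive Borel measure on ℝⁿ and κ ∈ ℕ. Then there is a constant C, depending only on n, κ and the doubling constant of μ, such that for every half-open axis-parallel cube I and every f ∈ L²_loc(μ): ‖E^μ_{I;κ} f‖_{L^∞(1_I μ)} ≤ C · (1/μ(I)) ∫_I |f| dμ ≤ C · ((1/μ(I)) ∫_I |f|² dμ)^{1/2}. -/

import Mathlib

open MeasureTheory Set

noncomputable section

def cubeOf {n : ℕ} (a : Fin n → ℝ) (ℓ : ℝ) : Set (Fin n → ℝ) :=
  {x | ∀ i, x i ∈ Set.Ico (a i) (a i + ℓ)}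

def HasSideLength {n : ℕ} (Q : Set (Fin n → ℝ)) (ℓ : ℝ) : Prop :=
  ∃ a, Q = cubeOf a ℓ

def IsCube {n : ℕ} (Q : Set (Fin n → ℝ)) : Prop :=
  ∃ ℓ > (0:ℝ), HasSideLength Q ℓ

def IsDyadicGrid {n : ℕ} (D : Set (Set (Fin n → ℝ))) : Prop :=
  (∀ Q ∈ D, ∃ k : ℤ, HasSideLength Q ((2:ℝ) ^ k)) ∧
  (∀ k : ℤ, ∀ x : Fin n → ℝ, ∃! Q, Q ∈ D ∧ HasSideLength Q ((2:ℝ) ^ k) ∧ x ∈ Q) ∧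
  (∀ k : ℤ, ∀ Q ∈ D, HasSideLength Q ((2:ℝ) ^ k) →
    ∃ C : Finset (Set (Fin n → ℝ)), C.card = 2 ^ n ∧ ↑C ⊆ D ∧
      (∀ Q' ∈ C, HasSideLength Q' ((2:ℝ) ^ (k - 1))) ∧ Q = ⋃₀ ↑C)

def IsTower {n : ℕ} (D : Set (Set (Fin n → ℝ))) (Γ : ℕ → Set (Fin n → ℝ)) : Prop :=
  (∀ m, Γ m ∈ D) ∧ (∀ m, Γ m ⊆ Γ (m + 1)) ∧
  (∀ m : ℕ, HasSideLength (Γ m) ((2:ℝ) ^ (m + 1)))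

def towerTop {n : ℕ} (Γ : ℕ → Set (Fin n → ℝ)) : Set (Fin n → ℝ) := ⋃ m, Γ m

def topsOf {n : ℕ} (D : Set (Set (Fin n → ℝ))) : Set (Set (Fin n → ℝ)) :=
  {S | ∃ Γ, IsTower D Γ ∧ towerTop Γ = S}

def IsChildOf {n : ℕ} (Q' Q : Set (Fin n → ℝ)) : Prop :=
  ∃ (a : Fin n → ℝ) (ℓ : ℝ) (ε : Fin n → Bool), 0 < ℓ ∧ Q = cubeOf a ℓ ∧
    Q' = cubeOf (fun i => a i + (if ε i then ℓ / 2 else 0)) (ℓ / 2)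

def IsPolyDegLT {n : ℕ} (κ : ℕ) (p : (Fin n → ℝ) → ℝ) : Prop :=
  ∃ P : MvPolynomial (Fin n) ℝ, P.totalDegree < κ ∧ ∀ x, p x = MvPolynomial.eval x P

def monomial' {n : ℕ} (β : Fin n → ℕ) : (Fin n → ℝ) → ℝ := fun x => ∏ i, (x i) ^ (β i)

def AlpertSet {n : ℕ} (μ : Measure (Fin n → ℝ)) (Q : Set (Fin n → ℝ)) (κ : ℕ) :
    Set (Lp ℝ 2 μ) :=
  {F | ∃ f : (Fin n → ℝ) → ℝ,
      (F : (Fin n → ℝ) → ℝ) =ᵐ[μ] f ∧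
      (∀ x, x ∉ Q → f x = 0) ∧
      (∀ Q', IsChildOf Q' Q → ∃ p, IsPolyDegLT κ p ∧ ∀ x ∈ Q', f x = p x) ∧
      (∀ β : Fin n → ℕ, (∑ i, β i) < κ → ∫ x in Q, f x * monomial' β x ∂μ = 0)}

def MonomialSet {n : ℕ} (μ : Measure (Fin n → ℝ)) (S : Set (Fin n → ℝ)) (κ : ℕ) :
    Set (Lp ℝ 2 μ) :=
  {F | ∃ β : Fin n → ℕ, (∑ i, β i) < κ ∧
      (F : (Fin n → ℝ) → ℝ) =ᵐ[μ] S.indicator (monomial' β)}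

def IsOrthProjOn {n : ℕ} {μ : Measure (Fin n → ℝ)} (V : Set (Lp ℝ 2 μ))
    (P : Lp ℝ 2 μ → Lp ℝ 2 μ) : Prop :=
  ∀ f, P f ∈ V ∧ ∀ g ∈ V, inner (𝕜 := ℝ) (f - P f) g = (0:ℝ)

/-- `μ` is a doubling measure with doubling constant `C`: `μ(2Q) ≤ C μ(Q)` for every cube `Q`
(`2Q` the concentric double), and `μ ≠ 0`. -/
def IsDoubling {n : ℕ} (μ : Measure (Fin n → ℝ)) (C : ℝ) : Prop :=
  μ ≠ 0 ∧ ∀ (a : Fin n → ℝ) (ℓ : ℝ), 0 < ℓ →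
    μ (cubeOf (fun i => a i - ℓ / 2) (2 * ℓ)) ≤ ENNReal.ofReal C * μ (cubeOf a ℓ)

theorem aux_equi {K E : Type*} [PseudoMetricSpace K] [CompactSpace K] [NormedAddCommGroup E]
    [NormedSpace ℝ E] [FiniteDimensional ℝ E] (φ : K → E →ₗ[ℝ] ℝ)
    (hφ : ∀ g, Continuous (fun x => φ x g)) (ε : ℝ) (hε : 0 < ε) :
    ∃ δ > 0, ∀ x y, dist x y < δ → ∀ g, |φ x g - φ y g| ≤ ε * ‖g‖ := by
  let ev : K → (E →L[ℝ] ℝ) := fun x => LinearMap.toContinuousLinearMap (φ x)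
  have hev : Continuous ev := by
    rw [continuous_clm_apply]
    exact hφ
  have huc : UniformContinuous ev := CompactSpace.uniformContinuous_of_continuous hev
  obtain ⟨δ, hδ, h⟩ := Metric.uniformContinuous_iff.mp huc ε hε
  refine ⟨δ, hδ, fun x y hxy g => ?_⟩
  have h1 := h hxy
  rw [dist_eq_norm] at h1
  have h2 := (ev x - ev y).le_opNorm g
  exact h2.trans (mul_le_mul_of_nonneg_right h1.le (norm_nonneg _))

theorem aux_poly (n m : ℕ) : ∃ δ : ℝ, 0 < δ ∧ ∀ P : MvPolynomial (Fin n) ℝ, P.totalDegree ≤ m →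
    ∃ M : ℝ, 0 ≤ M ∧ (∀ y ∈ Set.Icc (0 : Fin n → ℝ) 1, |MvPolynomial.eval y P| ≤ M) ∧
      ∃ y0 ∈ Set.Icc (0 : Fin n → ℝ) 1, ∀ y ∈ Set.Icc (0 : Fin n → ℝ) 1, dist y y0 < δ →
        M / 2 ≤ |MvPolynomial.eval y P| := by
  let K := Set.Icc (0 : Fin n → ℝ) 1
  have : CompactSpace K := isCompact_iff_compactSpace.mp isCompact_Icc
  let T : MvPolynomial (Fin n) ℝ →ₗ[ℝ] C(K, ℝ) :=
    { toFun := fun P => ⟨fun y => MvPolynomial.eval y.1 P,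
        (MvPolynomial.continuous_eval P).comp continuous_subtype_val⟩
      map_add' := by intro P Q; ext y; simp
      map_smul' := by intro c P; ext y; simp }
  let W : Submodule ℝ C(K, ℝ) := (MvPolynomial.restrictTotalDegree (Fin n) ℝ m).map T
  have : FiniteDimensional ℝ (MvPolynomial.restrictTotalDegree (Fin n) ℝ m) := by
    have hfin : {s : Fin n →₀ ℕ | (s.sum fun _ e => e) ≤ m}.Finite := by
      have : {s : Fin n →₀ ℕ | (s.sum fun _ e => e) ≤ m} ⊆
          Set.Iic (Finsupp.equivFunOnFinite.symm (fun _ : Fin n => m)) := by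
        intro s hs i
        simp only [Set.mem_ofPred_eq] at hs
        rw [Finsupp.sum_fintype _ _ (by simp)] at hs
        exact (Finset.single_le_sum (f := fun i => s i) (by simp) (Finset.mem_univ i)).trans hs
      exact (Set.finite_Iic _).subset this
    have := hfin.to_subtype
    exact Module.Finite.of_basis
      (MvPolynomial.basisRestrictSupport ℝ {s : Fin n →₀ ℕ | (s.sum fun _ e => e) ≤ m})
  have : FiniteDimensional ℝ W := inferInstance
  obtain ⟨δ, hδ, h⟩ := aux_equi (K := K) (E := W)
    (fun x => { toFun := fun g => g.1 x, map_add' := fun _ _ => rfl, map_smul' := fun _ _ => rfl })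
    (fun g => g.1.continuous) (1/2) (by norm_num)
  refine ⟨δ, hδ, fun P hP => ?_⟩
  have hPW : T P ∈ W := Submodule.mem_map_of_mem
    ((MvPolynomial.mem_restrictTotalDegree _ _ _).mpr hP)
  have hne : (Set.univ : Set K).Nonempty := ⟨⟨0, by simp [K]⟩, trivial⟩
  obtain ⟨y0, -, hy0⟩ := isCompact_univ.exists_isMaxOn hne
    ((T P).continuous.abs.continuousOn)
  have hmax : ∀ y : K, |T P y| ≤ |T P y0| := fun y => hy0 (Set.mem_univ y)
  have hnorm : ‖T P‖ ≤ |T P y0| := (ContinuousMap.norm_le _ (abs_nonneg _)).mpr hmax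
  refine ⟨|T P y0|, abs_nonneg _, fun y hy => hmax ⟨y, hy⟩, y0.1, y0.2, fun y hy hd => ?_⟩
  have h5 : |T P ⟨y, hy⟩ - T P y0| ≤ 1/2 * |T P y0| :=
    (h ⟨y, hy⟩ y0 hd ⟨T P, hPW⟩).trans (mul_le_mul_of_nonneg_left hnorm (by norm_num))
  have h6 := abs_sub_abs_le_abs_sub (T P y0) (T P ⟨y, hy⟩)
  rw [abs_sub_comm] at h6
  change _ ≤ |T P ⟨y, hy⟩|
  linarith

theorem aux_iter {n : ℕ} {μ : Measure (Fin n → ℝ)} {C : ℝ} (h : IsDoubling μ C)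
    (b : Fin n → ℝ) (s : ℝ) (hs : 0 < s) (k : ℕ) :
    μ (cubeOf (fun i => b i - (2 ^ k - 1) * s / 2) (2 ^ k * s)) ≤
      ENNReal.ofReal C ^ k * μ (cubeOf b s) := by
  induction k with
  | zero => simp
  | succ k ih =>
    have h1 := h.2 (fun i => b i - (2 ^ k - 1) * s / 2) (2 ^ k * s) (by positivity)
    have e1 : (fun i => b i - (2 ^ (k+1) - 1) * s / 2) =
        (fun i => (b i - (2 ^ k - 1) * s / 2) - (2 ^ k * s) / 2) := by
      funext i; ring
    have e2 : (2:ℝ) ^ (k+1) * s = 2 * (2 ^ k * s) := by ring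
    rw [e1, e2]
    calc _ ≤ _ := h1
      _ ≤ ENNReal.ofReal C * (ENNReal.ofReal C ^ k * μ (cubeOf b s)) := by gcongr
      _ = _ := by ring

theorem aux_pos {n : ℕ} {μ : Measure (Fin n → ℝ)} {C : ℝ} (h : IsDoubling μ C)
    (b : Fin n → ℝ) (s : ℝ) (hs : 0 < s) : μ (cubeOf b s) ≠ 0 := by
  intro h0
  apply h.1
  have hk : ∀ k : ℕ, μ (cubeOf (fun i => b i - (2 ^ k - 1) * s / 2) (2 ^ k * s)) = 0 := by
    intro k
    have := aux_iter h b s hs k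
    simpa [h0] using this
  have hu := measure_iUnion_null hk
  rw [← Measure.measure_univ_eq_zero]
  refine measure_mono_null ?_ hu
  intro x _
  obtain ⟨k, hkk⟩ := pow_unbounded_of_one_lt
    ((∑ i, (|x i - b i|)) * 2 / s + 1) (one_lt_two : (1:ℝ) < 2)
  refine Set.mem_iUnion.mpr ⟨k, fun i => ?_⟩
  have h1 : |x i - b i| ≤ ∑ i, |x i - b i| :=
    Finset.single_le_sum (f := fun i => |x i - b i|) (fun _ _ => abs_nonneg _) (Finset.mem_univ i)
  have h2 : (∑ i, (|x i - b i|)) * 2 < (2 ^ k - 1) * s := by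
    rw [← div_lt_iff₀ hs]; linarith
  have h3 := abs_le.mp h1
  constructor
  · simp only; nlinarith
  · simp only; nlinarith

theorem aux_sub {n : ℕ} {μ : Measure (Fin n → ℝ)} {C : ℝ} (h : IsDoubling μ C)
    (a : Fin n → ℝ) (ℓ : ℝ) (hℓ : 0 < ℓ) (m : ℕ) (y0 : Fin n → ℝ)
    (hy0 : y0 ∈ Set.Icc (0 : Fin n → ℝ) 1) :
    ∃ b : Fin n → ℝ, cubeOf b (ℓ / 2 ^ m) ⊆ cubeOf a ℓ ∧
      (∀ x ∈ cubeOf b (ℓ / 2 ^ m), ∀ i, |x i - (a i + ℓ * y0 i)| ≤ ℓ / 2 ^ m) ∧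
      μ (cubeOf a ℓ) ≤ ENNReal.ofReal C ^ (m + 1) * μ (cubeOf b (ℓ / 2 ^ m)) := by
  have hp : (0:ℝ) < 2 ^ m := by positivity
  have hp1 : (1:ℝ) ≤ 2 ^ m := one_le_pow₀ (by norm_num)
  set t : ℝ := 1 / 2 ^ m with ht
  have ht0 : 0 < t := by positivity
  have ht1 : t ≤ 1 := by rw [ht, div_le_one hp]; exact hp1
  have hst : ℓ / 2 ^ m = ℓ * t := by rw [ht]; ring
  have htm : 2 ^ m * t = 1 := by rw [ht]; field_simp
  have key : ∀ i, 0 ≤ min (y0 i) (1 - t) ∧ min (y0 i) (1 - t) ≤ 1 - t ∧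
      min (y0 i) (1 - t) ≤ y0 i ∧ y0 i ≤ min (y0 i) (1 - t) + t := by
    intro i
    have h0 : 0 ≤ y0 i := hy0.1 i
    have h1 : y0 i ≤ 1 := hy0.2 i
    refine ⟨le_min h0 (by linarith), min_le_right _ _, min_le_left _ _, ?_⟩
    rcases min_choice (y0 i) (1 - t) with h | h <;> rw [h] <;> linarith
  have hsub : ∀ x ∈ cubeOf (fun i => a i + ℓ * min (y0 i) (1 - t)) (ℓ * t), x ∈ cubeOf a ℓ := by
    intro x hx i
    obtain ⟨k1, k2, k3, k4⟩ := key i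
    obtain ⟨x1, x2⟩ := hx i
    simp only at x1 x2
    constructor
    · nlinarith
    · nlinarith
  refine ⟨fun i => a i + ℓ * min (y0 i) (1 - t), ?_, ?_, ?_⟩
  · rw [hst]; exact hsub
  · rw [hst]
    intro x hx i
    obtain ⟨k1, k2, k3, k4⟩ := key i
    obtain ⟨x1, x2⟩ := hx i
    simp only at x1 x2
    rw [abs_le]
    constructor
    · nlinarith
    · nlinarith
  · rw [hst]
    refine le_trans (measure_mono ?_) (aux_iter h _ (ℓ * t) (by positivity) (m + 1))
    intro x hx i
    obtain ⟨k1, k2, k3, k4⟩ := key i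
    obtain ⟨x1, x2⟩ := hx i
    have e1 : ((2:ℝ) ^ (m+1) - 1) * (ℓ * t) / 2 = ℓ - ℓ * t / 2 := by
      rw [pow_succ]; linear_combination ℓ * htm
    have e2 : (2:ℝ) ^ (m+1) * (ℓ * t) = 2 * ℓ := by
      rw [pow_succ]; linear_combination 2 * ℓ * htm
    simp only [e1, e2]
    constructor
    · nlinarith
    · nlinarith

theorem aux_rep {n κ : ℕ} {μ : Measure (Fin n → ℝ)} (a : Fin n → ℝ) (ℓ : ℝ) (hℓ : 0 < ℓ)
    (Ef : Lp ℝ 2 μ) (h : Ef ∈ Submodule.span ℝ (MonomialSet μ (cubeOf a ℓ) κ)) :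
    ∃ P : MvPolynomial (Fin n) ℝ, P.totalDegree ≤ κ ∧
      (Ef : (Fin n → ℝ) → ℝ) =ᵐ[μ]
        (cubeOf a ℓ).indicator (fun x => MvPolynomial.eval (fun i => (x i - a i) / ℓ) P) := by
  induction h using Submodule.span_induction with
  | mem F hF =>
    obtain ⟨β, hβ, hF⟩ := hF
    refine ⟨∏ i, (MvPolynomial.C (a i) + MvPolynomial.C ℓ * MvPolynomial.X i) ^ (β i), ?_, ?_⟩
    · refine (MvPolynomial.totalDegree_finsetProd _ _).trans (le_trans ?_ hβ.le)
      refine Finset.sum_le_sum fun i _ => ?_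
      refine (MvPolynomial.totalDegree_pow _ _).trans ?_
      have : (MvPolynomial.C (a i) + MvPolynomial.C ℓ * MvPolynomial.X i :
          MvPolynomial (Fin n) ℝ).totalDegree ≤ 1 := by
        refine (MvPolynomial.totalDegree_add _ _).trans (max_le (by simp) ?_)
        refine (MvPolynomial.totalDegree_mul _ _).trans (by simp)
      nlinarith
    · refine hF.trans (Filter.Eventually.of_forall fun x => ?_)
      congr 1
      funext x
      simp only [monomial', map_prod, map_pow, map_add, map_mul, MvPolynomial.eval_C,
        MvPolynomial.eval_X]
      refine Finset.prod_congr rfl fun i _ => ?_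
      congr 1
      field_simp
      ring
  | zero =>
    refine ⟨0, by simp, ?_⟩
    refine (Lp.coeFn_zero _ _ _).trans (Filter.Eventually.of_forall fun x => ?_)
    simp
  | add F G _ _ hF hG =>
    obtain ⟨P, hP, hF⟩ := hF
    obtain ⟨Q, hQ, hG⟩ := hG
    refine ⟨P + Q, (MvPolynomial.totalDegree_add _ _).trans (max_le hP hQ), ?_⟩
    filter_upwards [Lp.coeFn_add F G, hF, hG] with x h1 h2 h3
    rw [h1, Pi.add_apply, h2, h3]
    by_cases hx : x ∈ cubeOf a ℓ <;> simp [hx]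
  | smul c F _ hF =>
    obtain ⟨P, hP, hF⟩ := hF
    refine ⟨c • P, (MvPolynomial.totalDegree_smul_le _ _).trans hP, ?_⟩
    filter_upwards [Lp.coeFn_smul c F, hF] with x h1 h2
    rw [h1, Pi.smul_apply, h2]
    by_cases hx : x ∈ cubeOf a ℓ <;> simp [hx]

theorem aux_meas {n : ℕ} (a : Fin n → ℝ) (ℓ : ℝ) : MeasurableSet (cubeOf a ℓ) := by
  have : cubeOf a ℓ = Set.univ.pi (fun i => Set.Ico (a i) (a i + ℓ)) := by
    ext x; simp [cubeOf]
  rw [this]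
  exact MeasurableSet.univ_pi fun i => measurableSet_Ico

theorem aux_fin {n : ℕ} (μ : Measure (Fin n → ℝ)) [IsLocallyFiniteMeasure μ]
    (a : Fin n → ℝ) (ℓ : ℝ) : μ (cubeOf a ℓ) < ⊤ := by
  refine lt_of_le_of_lt (measure_mono (t := Set.Icc a (fun i => a i + ℓ)) ?_)
    (isCompact_Icc.measure_lt_top)
  intro x hx
  exact ⟨fun i => (hx i).1, fun i => (hx i).2.le⟩

theorem aux_cs {α : Type*} [MeasurableSpace α] (ν : Measure α) [IsFiniteMeasure ν]
    (h0 : ν.real Set.univ ≠ 0) (f : α → ℝ) (hf : MemLp f 2 ν) :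
    (ν.real Set.univ)⁻¹ * ∫ x, |f x| ∂ν ≤ Real.sqrt ((ν.real Set.univ)⁻¹ * ∫ x, (f x) ^ 2 ∂ν) := by
  have hm : 0 < ν.real Set.univ := lt_of_le_of_ne measureReal_nonneg (Ne.symm h0)
  have i1 : Integrable (fun x => |f x|) ν := (hf.integrable (by norm_num)).abs
  have i2 : Integrable (fun x => (f x) ^ 2) ν := hf.integrable_sq
  set A := (ν.real Set.univ)⁻¹ * ∫ x, |f x| ∂ν with hA
  have hA2 : ∫ x, |f x| ∂ν = A * ν.real Set.univ := by rw [hA]; field_simp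
  have h1 : 0 ≤ ∫ x, (|f x| - A) ^ 2 ∂ν := integral_nonneg fun x => sq_nonneg _
  have h2 : ∫ x, (|f x| - A) ^ 2 ∂ν =
      ∫ x, (f x) ^ 2 ∂ν - 2 * A * ∫ x, |f x| ∂ν + A ^ 2 * ν.real Set.univ := by
    have : (fun x => (|f x| - A) ^ 2) = fun x => ((f x) ^ 2 - 2 * A * |f x|) + A ^ 2 := by
      funext x; rw [sub_sq, sq_abs]; ring
    have i3 : Integrable (fun x => (f x) ^ 2 - 2 * A * |f x|) ν := i2.sub (i1.const_mul _)
    rw [this, integral_add i3 (integrable_const _),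
      integral_sub i2 (i1.const_mul _), integral_const_mul, integral_const]
    simp [mul_comm]
  apply Real.le_sqrt_of_sq_le
  rw [← div_eq_inv_mul, le_div_iff₀ hm]
  rw [h2, hA2] at h1
  nlinarith

/-- For a doubling measure `μ`, there is a constant `C` (depending only on `n`, `κ` and the
doubling constant) such that for every cube `I` and every `f ∈ L²_loc(μ)`, the projection
`E^μ_{I;κ} f` of `1_I f` onto `P^n_{I;κ}(μ)` satisfies
`‖E^μ_{I;κ} f‖_{L^∞(1_I μ)} ≤ C ⨍_I |f| dμ ≤ C (⨍_I |f|² dμ)^{1/2}`. -/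
theorem alpert_E_projection_Linfty_bound (n κ : ℕ) (Cμ : ℝ) :
    ∃ C : ℝ, 0 ≤ C ∧
      ∀ (μ : Measure (Fin n → ℝ)) [IsLocallyFiniteMeasure μ], IsDoubling μ Cμ →
        ∀ (a : Fin n → ℝ) (ℓ : ℝ), 0 < ℓ →
          ∀ f : (Fin n → ℝ) → ℝ,
            (∀ (b : Fin n → ℝ) (s : ℝ), 0 < s → MemLp ((cubeOf b s).indicator f) 2 μ) →
            ∀ fI Ef : Lp ℝ 2 μ,
              (fI : (Fin n → ℝ) → ℝ) =ᵐ[μ] (cubeOf a ℓ).indicator f →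
              Ef ∈ Submodule.span ℝ (MonomialSet μ (cubeOf a ℓ) κ) →
              (∀ g ∈ Submodule.span ℝ (MonomialSet μ (cubeOf a ℓ) κ),
                inner (𝕜 := ℝ) (fI - Ef) g = (0:ℝ)) →
              eLpNorm (Ef : (Fin n → ℝ) → ℝ) ⊤ (μ.restrict (cubeOf a ℓ)) ≤
                  ENNReal.ofReal
                    (C * (((μ (cubeOf a ℓ)).toReal)⁻¹ * ∫ x in cubeOf a ℓ, |f x| ∂μ)) ∧
                C * (((μ (cubeOf a ℓ)).toReal)⁻¹ * ∫ x in cubeOf a ℓ, |f x| ∂μ) ≤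
                  C * Real.sqrt (((μ (cubeOf a ℓ)).toReal)⁻¹ *
                    ∫ x in cubeOf a ℓ, (f x) ^ 2 ∂μ) := by
  obtain ⟨δ, hδ, hpoly⟩ := aux_poly n κ
  obtain ⟨m, hm⟩ := exists_pow_lt_of_lt_one hδ (by norm_num : (1/2 : ℝ) < 1)
  refine ⟨4 * (max Cμ 0) ^ (m + 1), by positivity, ?_⟩
  intro μ _ hμ a ℓ hℓ f hf fI Ef hfI hEf horth
  have hfin : μ (cubeOf a ℓ) < ⊤ := aux_fin μ a ℓ
  have hI : MeasurableSet (cubeOf a ℓ) := aux_meas a ℓ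
  have hne : μ (cubeOf a ℓ) ≠ 0 := aux_pos hμ a ℓ hℓ
  have hμpos : 0 < (μ (cubeOf a ℓ)).toReal := ENNReal.toReal_pos hne hfin.ne
  have : IsFiniteMeasure (μ.restrict (cubeOf a ℓ)) := ⟨by simpa using hfin⟩
  have hfL : MemLp f 2 (μ.restrict (cubeOf a ℓ)) :=
    (memLp_indicator_iff_restrict hI).mp (hf a ℓ hℓ)
  have hfint : Integrable (fun x => |f x|) (μ.restrict (cubeOf a ℓ)) :=
    (hfL.integrable (by norm_num)).abs
  constructor
  · obtain ⟨P, hP, hEP⟩ := aux_rep a ℓ hℓ Ef hEf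
    obtain ⟨M, hM0, hMb, y0, hy0, hMl⟩ := hpoly P hP
    obtain ⟨b, hb1, hb2, hb3⟩ := aux_sub hμ a ℓ hℓ m y0 hy0
    have hyI : ∀ x ∈ cubeOf a ℓ, (fun i => (x i - a i) / ℓ) ∈ Set.Icc (0 : Fin n → ℝ) 1 := by
      intro x hx
      refine ⟨fun i => ?_, fun i => ?_⟩
      · exact div_nonneg (by linarith [(hx i).1]) hℓ.le
      · simp only [Pi.one_apply]
        rw [div_le_one hℓ]; linarith [(hx i).2]
    have hEfM : ∀ᵐ x ∂μ, |Ef x| ≤ M := by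
      filter_upwards [hEP] with x hx
      rw [hx]
      by_cases hxI : x ∈ cubeOf a ℓ
      · rw [Set.indicator_of_mem hxI]; exact hMb _ (hyI x hxI)
      · rw [Set.indicator_of_notMem hxI]; simpa using hM0
    -- lower bound
    have hEfsq : Integrable (fun x => (Ef x) ^ 2) μ := (Lp.memLp Ef).integrable_sq
    have hlow : (M / 2) ^ 2 * (μ (cubeOf b (ℓ / 2 ^ m))).toReal ≤ ∫ x, (Ef x) ^ 2 ∂μ := by
      have h1 : ∀ᵐ x ∂μ, x ∈ cubeOf b (ℓ / 2 ^ m) → (M / 2) ^ 2 ≤ (Ef x) ^ 2 := by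
        filter_upwards [hEP] with x hx hxb
        have hxI := hb1 hxb
        rw [hx, Set.indicator_of_mem hxI, ← sq_abs (MvPolynomial.eval _ P)]
        refine pow_le_pow_left₀ (by linarith) (hMl _ (hyI x hxI) ?_) 2
        rw [dist_pi_lt_iff hδ]
        intro i
        have h2 := hb2 x hxb i
        rw [Real.dist_eq]
        have e : (x i - a i) / ℓ - y0 i = (x i - (a i + ℓ * y0 i)) / ℓ := by
          field_simp; ring
        rw [e, abs_div, abs_of_pos hℓ, div_lt_iff₀ hℓ]
        refine lt_of_le_of_lt h2 ?_
        have : ℓ / 2 ^ m = (1/2) ^ m * ℓ := by rw [div_pow]; ring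
        rw [this]
        exact mul_lt_mul_of_pos_right hm hℓ
      calc (M / 2) ^ 2 * (μ (cubeOf b (ℓ / 2 ^ m))).toReal
          = ∫ x in cubeOf b (ℓ / 2 ^ m), (M / 2) ^ 2 ∂μ := by
            rw [setIntegral_const, smul_eq_mul, mul_comm]; rfl
        _ ≤ ∫ x in cubeOf b (ℓ / 2 ^ m), (Ef x) ^ 2 ∂μ := by
            refine setIntegral_mono_on_ae ?_ hEfsq.integrableOn (aux_meas _ _) h1
            exact integrableOn_const (aux_fin μ _ _).ne
        _ ≤ ∫ x, (Ef x) ^ 2 ∂μ := setIntegral_le_integral hEfsq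
            (Filter.Eventually.of_forall fun x => sq_nonneg _)
    -- upper bound
    have hup : ∫ x, (Ef x) ^ 2 ∂μ ≤ M * ∫ x in cubeOf a ℓ, |f x| ∂μ := by
      have h1 := horth Ef hEf
      rw [inner_sub_left, sub_eq_zero, L2.inner_def, L2.inner_def] at h1
      have e1 : ∫ x, (Ef x) ^ 2 ∂μ = ∫ x, inner ℝ (Ef x) (Ef x) ∂μ := by
        refine integral_congr_ae (Filter.Eventually.of_forall fun x => ?_)
        simp [sq]
      rw [e1, ← h1, ← integral_const_mul, ← integral_indicator hI]
      refine integral_mono_ae (L2.integrable_inner fI Ef)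
        ((integrable_indicator_iff hI).mpr (hfint.const_mul M)) ?_
      filter_upwards [hfI, hEfM] with x h2 h3
      rw [h2]
      by_cases hx : x ∈ cubeOf a ℓ
      · simp only [hx, Set.indicator_of_mem]
        refine (real_inner_le_norm _ _).trans ?_
        rw [Real.norm_eq_abs, Real.norm_eq_abs, mul_comm]
        exact mul_le_mul_of_nonneg_right h3 (abs_nonneg _)
      · simp [hx]
    have hdb : (μ (cubeOf a ℓ)).toReal ≤
        (max Cμ 0) ^ (m + 1) * (μ (cubeOf b (ℓ / 2 ^ m))).toReal := by
      have := ENNReal.toReal_mono (ENNReal.mul_ne_top (ENNReal.pow_ne_top ENNReal.ofReal_ne_top)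
        (aux_fin μ b (ℓ / 2 ^ m)).ne) hb3
      rwa [ENNReal.toReal_mul, ENNReal.toReal_pow, ENNReal.toReal_ofReal'] at this
    have hF0 : 0 ≤ ∫ x in cubeOf a ℓ, |f x| ∂μ := integral_nonneg fun x => abs_nonneg _
    have hfinal : M ≤ 4 * (max Cμ 0) ^ (m + 1) *
        (((μ (cubeOf a ℓ)).toReal)⁻¹ * ∫ x in cubeOf a ℓ, |f x| ∂μ) := by
      rcases hM0.eq_or_lt with h | hMpos
      · rw [← h]; positivity
      · have h2 : M * (μ (cubeOf b (ℓ / 2 ^ m))).toReal ≤ 4 * ∫ x in cubeOf a ℓ, |f x| ∂μ := by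
          have := hlow.trans hup
          refine le_of_mul_le_mul_left ?_ hMpos
          nlinarith
        have h3 : M * (μ (cubeOf a ℓ)).toReal ≤
            4 * (max Cμ 0) ^ (m + 1) * ∫ x in cubeOf a ℓ, |f x| ∂μ := by
          have hc : (0:ℝ) ≤ (max Cμ 0) ^ (m + 1) := by positivity
          calc _ ≤ M * ((max Cμ 0) ^ (m + 1) * (μ (cubeOf b (ℓ / 2 ^ m))).toReal) :=
                mul_le_mul_of_nonneg_left hdb hM0
            _ = (max Cμ 0) ^ (m + 1) * (M * (μ (cubeOf b (ℓ / 2 ^ m))).toReal) := by ring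
            _ ≤ (max Cμ 0) ^ (m + 1) * (4 * ∫ x in cubeOf a ℓ, |f x| ∂μ) :=
                mul_le_mul_of_nonneg_left h2 hc
            _ = _ := by ring
        rw [← le_div_iff₀ hμpos] at h3
        refine h3.trans (le_of_eq ?_)
        rw [div_eq_mul_inv]; ring
    rw [eLpNorm_exponent_top]
    refine eLpNormEssSup_le_of_ae_enorm_bound ?_
    refine ae_restrict_of_ae ?_
    filter_upwards [hEfM] with x hx
    rw [Real.enorm_eq_ofReal_abs]
    exact ENNReal.ofReal_le_ofReal (hx.trans hfinal)
  · refine mul_le_mul_of_nonneg_left ?_ (by positivity)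
    have e : (μ.restrict (cubeOf a ℓ)).real Set.univ = (μ (cubeOf a ℓ)).toReal := by
      simp [Measure.real]
    have := aux_cs (μ.restrict (cubeOf a ℓ)) (by rw [e]; exact hμpos.ne') f hfL
    rwa [e] at this

end
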